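/- arXiv:2506.10118 — 2 statements merged into one kernel-verified Lean document; each statement's English description precedes it below -/
import Mathlib

section
/- Let M, K ∈ ℂ^{n×n}, B ∈ ℂ^{n×m}, C_p ∈ ℂ^{p×n}, and let f, g : ℂ → ℂ be differentiable at a point s₀ ∈ ℂ. Define φ(s) = s²M + s(f(s)M + g(s)K) + K, d(s) = 1 + s·g(s), n(s) = s² + s·f(s), h(s) = n(s)/d(s), and G(s) = C_p φ(s)⁻¹ B. Suppose d(s₀) ≠ 0, φ(s₀) is invertible, and h'(s₀) ≠ 0, where h'(s₀) is the complex derivative of h at s₀. Then C_p φ(s₀)⁻¹ K φ(s₀)⁻¹ B = d(s₀)⁻² · ((n·G)'(s₀)) · (h'(s₀))⁻¹, where (n·G)'(s₀) denotes the entrywise complex derivative of the matrix-valued function s ↦ n(s)G(s) at s₀. -/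
open Matrix Complex

/-- The second-order resolvent pencil with generalized proportional damping
`D(s) = f(s)M + g(s)K`: `φ(s) = s²M + s(f(s)M + g(s)K) + K`. -/
noncomputable def phi {n : ℕ} (M K : Matrix (Fin n) (Fin n) ℂ) (f g : ℂ → ℂ) (s : ℂ) :
    Matrix (Fin n) (Fin n) ℂ :=
  s ^ 2 • M + s • (f s • M + g s • K) + K

/-- `d(s) = 1 + s·g(s)`. -/
noncomputable def dfun (g : ℂ → ℂ) (s : ℂ) : ℂ := 1 + s * g s

/-- `n(s) = s² + s·f(s)`. -/
noncomputable def nfun (f : ℂ → ℂ) (s : ℂ) : ℂ := s ^ 2 + s * f s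

/-- `h(s) = n(s)/d(s)`. -/
noncomputable def hfun (f g : ℂ → ℂ) (s : ℂ) : ℂ := nfun f s / dfun g s

/-- Transfer function with position-only output: `G(s) = C_p φ(s)⁻¹ B`. -/
noncomputable def Gtf {n m p : ℕ} (M K : Matrix (Fin n) (Fin n) ℂ)
    (B : Matrix (Fin n) (Fin m) ℂ) (Cp : Matrix (Fin p) (Fin n) ℂ)
    (f g : ℂ → ℂ) (s : ℂ) : Matrix (Fin p) (Fin m) ℂ :=
  Cp * (phi M K f g s)⁻¹ * B

section

open scoped Matrix.Norms.Operator

/-- The derivative of the inverse of a matrix-valued curve. -/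
theorem hasDerivAt_matrix_inv {n : ℕ} {A : ℂ → Matrix (Fin n) (Fin n) ℂ}
    {A' : Matrix (Fin n) (Fin n) ℂ} {s : ℂ} (hA : HasDerivAt A A' s) (hu : IsUnit (A s)) :
    HasDerivAt (fun z => (A z)⁻¹) (-((A s)⁻¹ * A' * (A s)⁻¹)) s := by
  obtain ⟨u, hu⟩ := hu
  have h := hasFDerivAt_ringInverse (𝕜 := ℂ) u
  rw [hu] at h
  have h' := h.comp_hasDerivAt s hA
  have hinv : (↑u⁻¹ : Matrix (Fin n) (Fin n) ℂ) = (A s)⁻¹ := by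
    rw [← hu, Matrix.coe_units_inv]
  simp only [Function.comp_def, ← Matrix.nonsing_inv_eq_ringInverse, hinv,
    _root_.neg_apply, ContinuousLinearMap.mulLeftRight_apply] at h'
  exact h'

/-- The derivative of `C (a (a M + d K)⁻¹) B`, entry by entry. -/
theorem hasDerivAt_smul_linear_pencil_inv {n m p : ℕ} (M K : Matrix (Fin n) (Fin n) ℂ)
    (B : Matrix (Fin n) (Fin m) ℂ) (C : Matrix (Fin p) (Fin n) ℂ) {a d : ℂ → ℂ} {a' d' s : ℂ}
    (ha : HasDerivAt a a' s) (hd : HasDerivAt d d' s) (hu : IsUnit (a s • M + d s • K))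
    (i : Fin p) (j : Fin m) :
    HasDerivAt (fun z => a z * (C * (a z • M + d z • K)⁻¹ * B) i j)
      ((a' * d s - a s * d') *
        (C * (a s • M + d s • K)⁻¹ * K * (a s • M + d s • K)⁻¹ * B) i j) s := by
  have hinv := hasDerivAt_matrix_inv ((ha.smul_const M).add (hd.smul_const K)) hu
  let L : Matrix (Fin n) (Fin n) ℂ →ₗ[ℂ] ℂ :=
    { toFun := fun X => (C * X * B) i j
      map_add' := fun X Y => by simp [Matrix.mul_add, Matrix.add_mul]
      map_smul' := fun c X => by simp }
  have hL := (LinearMap.toContinuousLinearMap L).hasFDerivAt.comp_hasDerivAt s (ha.smul hinv)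
  set X := (a s • M + d s • K)⁻¹ with hX
  have hXX : X * (a s • M + d s • K) * X = X := by
    rw [hX, Matrix.nonsing_inv_mul _ ((Matrix.isUnit_iff_isUnit_det _).mp hu), one_mul]
  have key : a s • -(X * (a' • M + d' • K) * X) + a' • X =
      (a' * d s - a s * d') • (X * K * X) := by
    nth_rewrite 3 [← hXX]
    simp only [Matrix.mul_add, Matrix.add_mul, Matrix.mul_smul, Matrix.smul_mul]
    module
  have hfun : (fun z => a z * (C * (a z • M + d z • K)⁻¹ * B) i j) =
      fun z => L (a z • (a z • M + d z • K)⁻¹) := by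
    ext z
    simp [L]
  have hval : (a' * d s - a s * d') * (C * X * K * X * B) i j =
      L (a s • -(X * (a' • M + d' • K) * X) + a' • X) := by
    rw [key]
    simp [L, Matrix.mul_assoc]
  rw [hfun, hval]
  exact hL

end

/-- The pencil is `n(s)M + d(s)K`. -/
theorem phi_eq {n : ℕ} (M K : Matrix (Fin n) (Fin n) ℂ) (f g : ℂ → ℂ) (s : ℂ) :
    phi M K f g s = nfun f s • M + dfun g s • K := by
  simp only [phi, nfun, dfun]
  module

/-- The confluent (Hermite) diagonal-block formula of Theorem 4.1 for the `𝕂` data: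
`C_p φ(s₀)⁻¹ K φ(s₀)⁻¹ B = d(s₀)⁻² · (n·G)'(s₀) · (h'(s₀))⁻¹`,
where `(n·G)'` is the entrywise complex derivative. -/
theorem K_block_confluent {n m p : ℕ} (M K : Matrix (Fin n) (Fin n) ℂ)
    (B : Matrix (Fin n) (Fin m) ℂ) (Cp : Matrix (Fin p) (Fin n) ℂ)
    (f g : ℂ → ℂ) (s₀ : ℂ)
    (hf : DifferentiableAt ℂ f s₀) (hg : DifferentiableAt ℂ g s₀)
    (hd : dfun g s₀ ≠ 0) (hφ : IsUnit (phi M K f g s₀))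
    (hh' : deriv (hfun f g) s₀ ≠ 0) :
    Cp * (phi M K f g s₀)⁻¹ * K * (phi M K f g s₀)⁻¹ * B =
      (((dfun g s₀) ^ 2)⁻¹ * (deriv (hfun f g) s₀)⁻¹) •
        Matrix.of (fun i j =>
          deriv (fun s => nfun f s * Gtf M K B Cp f g s i j) s₀) := by
  have hn : HasDerivAt (nfun f) (deriv (nfun f) s₀) s₀ :=
    ((differentiableAt_id.pow 2).add (differentiableAt_id.mul hf)).hasDerivAt
  have hdd : HasDerivAt (dfun g) (deriv (dfun g) s₀) s₀ :=
    ((differentiableAt_const 1).add (differentiableAt_id.mul hg)).hasDerivAt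
  have hh : deriv (hfun f g) s₀ =
      (deriv (nfun f) s₀ * dfun g s₀ - nfun f s₀ * deriv (dfun g) s₀) / dfun g s₀ ^ 2 :=
    (hn.div hdd hd).deriv
  have hw : deriv (nfun f) s₀ * dfun g s₀ - nfun f s₀ * deriv (dfun g) s₀ =
      dfun g s₀ ^ 2 * deriv (hfun f g) s₀ := by
    rw [hh]
    field_simp
  simp only [phi_eq] at hφ
  ext i j
  simp only [Gtf, phi_eq, Matrix.smul_apply, Matrix.of_apply, smul_eq_mul]
  rw [(hasDerivAt_smul_linear_pencil_inv M K B Cp hn hdd hφ i j).deriv, hw]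
  field_simp
end

section
/- Let M̃, K̃ ∈ ℂ^{r×r}, B̃ ∈ ℂ^{r×m}, C̃_p, C̃_v ∈ ℂ^{p×r}, let g_k ∈ ℂ^{p×m}, and let s_k ∈ ℂ. Define φ_R(s, α, β) = (s² + sα)M̃ + (1 + sβ)K̃ and 𝒞(s) = C̃_p + sC̃_v. Fix (α, β) ∈ ℝ² such that φ_R(s_k, α, β) is invertible, and define J(b) = ‖g_k − 𝒞(s_k) φ_R(s_k, α, b)⁻¹ B̃‖_F² for b in a neighborhood of β on which φ_R(s_k, α, b) is invertible. Then J is differentiable at β with derivative J'(β) = 2·Re( s_k · trace( K̃ φ_R(s_k, α, β)⁻¹ B̃ (g_k − 𝒞(s_k) φ_R(s_k, α, β)⁻¹ B̃)ᴴ 𝒞(s_k) φ_R(s_k, α, β)⁻¹ ) ). -/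
open Matrix

/-- Rayleigh-damped reduced resolvent `φ_R(s, α, β) = (s² + sα)M̃ + (1 + sβ)K̃`. -/
noncomputable def phiR {r : ℕ} (Mt Kt : Matrix (Fin r) (Fin r) ℂ) (s : ℂ) (a b : ℝ) :
    Matrix (Fin r) (Fin r) ℂ :=
  (s ^ 2 + s * (a : ℂ)) • Mt + (1 + s * (b : ℂ)) • Kt

/-- Output map `𝒞(s) = C̃_p + s C̃_v`. -/
noncomputable def Cout {r p : ℕ} (Cpt Cvt : Matrix (Fin p) (Fin r) ℂ) (s : ℂ) :
    Matrix (Fin p) (Fin r) ℂ :=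
  Cpt + s • Cvt

/-- Squared Frobenius norm of a complex matrix. -/
noncomputable def frobNormSq {a b : Type*} [Fintype a] [Fintype b]
    (A : Matrix a b ℂ) : ℝ :=
  ∑ i, ∑ j, ‖A i j‖ ^ 2

section Derivatives

open scoped Matrix.Norms.Operator

/-- Derivative of the inverse of a matrix-valued curve at a point where it is invertible. -/
theorem HasDerivAt.matrix_inv {n : Type*} [Fintype n] [DecidableEq n]
    {A : ℝ → Matrix n n ℂ} {A' : Matrix n n ℂ} {t : ℝ} (hA : HasDerivAt A A' t)
    (hu : IsUnit (A t)) :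
    HasDerivAt (fun x => (A x)⁻¹) (-((A t)⁻¹ * A' * (A t)⁻¹)) t := by
  obtain ⟨u, hu⟩ := hu
  have h := hasFDerivAt_ringInverse (𝕜 := ℝ) u
  rw [hu] at h
  have h' := h.comp_hasDerivAt t hA
  have hui : (↑u⁻¹ : Matrix n n ℂ) = (A t)⁻¹ := by rw [Matrix.coe_units_inv, hu]
  simp only [Function.comp_def, ← Matrix.nonsing_inv_eq_ringInverse, hui] at h'
  exact h'

theorem hasDerivAt_phiR {r : ℕ} (Mt Kt : Matrix (Fin r) (Fin r) ℂ) (s : ℂ) (α β : ℝ) :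
    HasDerivAt (phiR Mt Kt s α) (s • Kt) β := by
  have h : HasDerivAt (fun b : ℝ => 1 + s * (b : ℂ)) s β := by
    simpa using ((Complex.ofRealCLM.hasDerivAt (x := β)).const_mul s).const_add 1
  exact (h.smul_const Kt).const_add _

theorem HasDerivAt.matrix_apply {m n : Type*} [Fintype m] [Fintype n]
    {A : ℝ → Matrix m n ℂ} {A' : Matrix m n ℂ} {t : ℝ} (hA : HasDerivAt A A' t)
    (i : m) (j : n) : HasDerivAt (fun x => A x i j) (A' i j) t :=
  ((Matrix.entryLinearMap ℝ ℂ i j).toContinuousLinearMap.hasFDerivAt).comp_hasDerivAt t hA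

theorem HasDerivAt.const_matrix_mul_mul_const {l m n o : Type*} [Fintype l] [Fintype m]
    [Fintype n] [Fintype o] {A : ℝ → Matrix m n ℂ} {A' : Matrix m n ℂ} {t : ℝ}
    (hA : HasDerivAt A A' t) (C : Matrix l m ℂ) (B : Matrix n o ℂ) :
    HasDerivAt (fun x => C * A x * B) (C * A' * B) t :=
  (((mulRightLinearMap l ℝ B).comp (mulLeftLinearMap n ℝ C)).toContinuousLinearMap.hasFDerivAt
    ).comp_hasDerivAt t hA

theorem HasDerivAt.const_matrix_sub {m n : Type*} [Fintype m] [Fintype n]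
    {A : ℝ → Matrix m n ℂ} {A' : Matrix m n ℂ} {t : ℝ} (hA : HasDerivAt A A' t)
    (G : Matrix m n ℂ) : HasDerivAt (fun x => G - A x) (-A') t :=
  hA.const_sub G

theorem HasDerivAt.frobNormSq {m n : Type*} [Fintype m] [Fintype n]
    {A : ℝ → Matrix m n ℂ} {A' : Matrix m n ℂ} {t : ℝ} (hA : HasDerivAt A A' t) :
    HasDerivAt (fun x => frobNormSq (A x)) (2 * (trace (A' * (A t)ᴴ)).re) t := by
  have h := HasDerivAt.fun_sum (u := Finset.univ) fun i _ =>
    HasDerivAt.fun_sum (u := Finset.univ) fun j _ => (hA.matrix_apply i j).norm_sq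
  convert! h using 1
  simp [trace, mul_apply, Finset.mul_sum, Complex.inner]

end Derivatives

/-- Gradient of the least-squares objective with respect to the Rayleigh damping
coefficient `β` (Theorem 5.1, formula (5.5b)). -/
theorem deriv_J_beta {r m p : ℕ} (Mt Kt : Matrix (Fin r) (Fin r) ℂ)
    (Bt : Matrix (Fin r) (Fin m) ℂ) (Cpt Cvt : Matrix (Fin p) (Fin r) ℂ)
    (gk : Matrix (Fin p) (Fin m) ℂ) (sk : ℂ) (α β : ℝ)
    (hinv : IsUnit (phiR Mt Kt sk α β)) :
    HasDerivAt (fun b : ℝ => frobNormSq (gk - Cout Cpt Cvt sk * (phiR Mt Kt sk α b)⁻¹ * Bt))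
      (2 * (sk * Matrix.trace (Kt * (phiR Mt Kt sk α β)⁻¹ * Bt *
          (gk - Cout Cpt Cvt sk * (phiR Mt Kt sk α β)⁻¹ * Bt)ᴴ *
          Cout Cpt Cvt sk * (phiR Mt Kt sk α β)⁻¹)).re)
      β := by
  have h := ((((hasDerivAt_phiR Mt Kt sk α β).matrix_inv hinv).const_matrix_mul_mul_const
    (Cout Cpt Cvt sk) Bt).const_matrix_sub gk).frobNormSq
  convert h using 3
  set P := (phiR Mt Kt sk α β)⁻¹
  set C := Cout Cpt Cvt sk
  set R := gk - C * P * Bt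
  rw [show -(C * -(P * sk • Kt * P) * Bt) * Rᴴ = sk • ((C * P) * (Kt * P * Bt * Rᴴ)) by
    simp [Matrix.mul_assoc], trace_smul, smul_eq_mul, trace_mul_comm (C * P),
    Matrix.mul_assoc _ C P]
end
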